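/- Let B > 0 and s > 0. With X(s)_{mn} = −(1/(4B(n−m)²))·min{γ_m(s)/γ_n(s), γ_n(s)/γ_m(s)} for m ≠ n in ℕ∪{0}, the derivatives d/ds X(s)_{mn} exist and satisfy the square-summability bound (∑_{m≠n} |d/ds X(s)_{mn}|²)^{1/2} ≤ (1+√2)·π²/(48B); in particular the matrix of derivatives defines a Hilbert–Schmidt operator on ℓ²(ℕ∪{0}) with Hilbert–Schmidt norm at most (1+√2)·π²/(48B). -/

import Mathlib

/-- `γ_n(s) = (Γ(n+|s|+1)/n!)^{1/2}`. -/
noncomputable def gammaCoef (s : ℝ) (n : ℕ) : ℝ :=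
  Real.sqrt (Real.Gamma ((n : ℝ) + |s| + 1) / (Nat.factorial n : ℝ))

/-- The entry `X(s)_{mn}` (for `s > 0`) as a function of `s`. -/
noncomputable def Xentry (B : ℝ) (m n : ℕ) (s : ℝ) : ℝ :=
  -(1 / (4 * B * ((n : ℝ) - (m : ℝ)) ^ 2)) *
    min (gammaCoef s m / gammaCoef s n) (gammaCoef s n / gammaCoef s m)

theorem gammaCoef_pos (s : ℝ) (n : ℕ) : 0 < gammaCoef s n := by
  have h : 0 < Real.Gamma ((n : ℝ) + |s| + 1) := Real.Gamma_pos_of_pos (by positivity)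
  unfold gammaCoef
  positivity

theorem gammaCoef_succ (s : ℝ) (n : ℕ) :
    gammaCoef s (n + 1) = gammaCoef s n * √(1 + |s| / ((n : ℝ) + 1)) := by
  have h : 0 < Real.Gamma ((n : ℝ) + |s| + 1) := Real.Gamma_pos_of_pos (by positivity)
  have hne : (n : ℝ) + |s| + 1 ≠ 0 := by positivity
  unfold gammaCoef
  rw [← Real.sqrt_mul (by positivity), Nat.factorial_succ]
  congr 1
  have : ((n + 1 : ℕ) : ℝ) + |s| + 1 = ((n : ℝ) + |s| + 1) + 1 := by push_cast; ring
  rw [this, Real.Gamma_add_one hne]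
  push_cast
  field_simp
  ring

theorem gammaCoef_div_gammaCoef_add (s : ℝ) (m k : ℕ) :
    gammaCoef s m / gammaCoef s (m + k) =
      ∏ i ∈ Finset.range k, (√(1 + |s| / ((m : ℝ) + i + 1)))⁻¹ := by
  induction k with
  | zero => simp [(gammaCoef_pos s m).ne']
  | succ k ih =>
    rw [Finset.prod_range_succ, ← ih, ← add_assoc, gammaCoef_succ, div_mul_eq_div_div,
      div_eq_mul_inv (_ / _)]
    push_cast
    rfl

theorem inv_sqrt_one_add_div_le_one {a s : ℝ} (ha : 0 < a) (hs : 0 ≤ s) :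
    (√(1 + s / a))⁻¹ ≤ 1 := by
  apply inv_le_one_of_one_le₀
  rw [Real.one_le_sqrt]
  have : 0 ≤ s / a := by positivity
  linarith

theorem exists_hasDerivAt_inv_sqrt_one_add_div {a s : ℝ} (ha : 0 < a) (hs : 0 ≤ s) :
    ∃ d, HasDerivAt (fun t : ℝ => (√(1 + t / a))⁻¹) d s ∧ |d| ≤ 1 / (2 * a) := by
  have hw : 1 ≤ 1 + s / a := by
    have : 0 ≤ s / a := by positivity
    linarith
  have hr : 1 ≤ √(1 + s / a) := Real.one_le_sqrt.2 hw
  have h1 : HasDerivAt (fun t : ℝ => 1 + t / a) (1 / a) s :=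
    ((hasDerivAt_id s).div_const a).const_add 1
  refine ⟨_, (h1.sqrt (by positivity)).inv (by positivity), ?_⟩
  rw [neg_div, abs_neg, abs_of_nonneg (by positivity), div_div, div_div]
  apply one_div_le_one_div_of_le (by positivity)
  have h3 : 1 ≤ √(1 + s / a) * √(1 + s / a) ^ 2 := one_le_mul_of_one_le_of_one_le hr (one_le_pow₀ hr)
  nlinarith

theorem exists_hasDerivAt_prod_inv_sqrt {s : ℝ} (hs : 0 ≤ s) (a : ℕ → ℝ) (ha : ∀ i, 0 < a i)
    (k : ℕ) :
    ∃ d, HasDerivAt (fun t : ℝ => ∏ i ∈ Finset.range k, (√(1 + t / a i))⁻¹) d s ∧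
      |d| ≤ ∑ i ∈ Finset.range k, 1 / (2 * a i) := by
  induction k with
  | zero => exact ⟨0, by simpa using hasDerivAt_const s (1 : ℝ), by simp⟩
  | succ k ih =>
    obtain ⟨d, hd, hdle⟩ := ih
    obtain ⟨e, he, hele⟩ := exists_hasDerivAt_inv_sqrt_one_add_div (ha k) hs
    simp only [Finset.prod_range_succ, Finset.sum_range_succ]
    refine ⟨_, hd.mul he, (abs_add_le _ _).trans (add_le_add ?_ ?_)⟩
    · rw [abs_mul, abs_of_nonneg (a := (√(1 + s / a k))⁻¹) (by positivity)]
      exact (mul_le_of_le_one_right (abs_nonneg _)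
        (inv_sqrt_one_add_div_le_one (ha k) hs)).trans hdle
    · rw [abs_mul, abs_of_nonneg (Finset.prod_nonneg fun i _ => by positivity)]
      exact (mul_le_of_le_one_left (abs_nonneg _) (Finset.prod_le_one (fun i _ => by positivity)
        fun i _ => inv_sqrt_one_add_div_le_one (ha i) hs)).trans hele

theorem Xentry_comm (B : ℝ) (m n : ℕ) : Xentry B m n = Xentry B n m := by
  funext s
  unfold Xentry
  rw [min_comm, ← neg_sub (m : ℝ) n, neg_sq]

theorem Xentry_add (B : ℝ) (m k : ℕ) {s : ℝ} (hs : 0 ≤ s) :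
    Xentry B m (m + k) s = -(1 / (4 * B * (k : ℝ) ^ 2)) *
      ∏ i ∈ Finset.range k, (√(1 + s / ((m : ℝ) + i + 1)))⁻¹ := by
  have h := gammaCoef_div_gammaCoef_add s m k
  rw [abs_of_nonneg hs] at h
  have hle : gammaCoef s m / gammaCoef s (m + k) ≤ 1 := by
    rw [h]
    exact Finset.prod_le_one (fun i _ => by positivity)
      fun i _ => inv_sqrt_one_add_div_le_one (by positivity) hs
  have hge : 1 ≤ gammaCoef s (m + k) / gammaCoef s m := by
    rw [← inv_div]
    exact (one_le_inv₀ (div_pos (gammaCoef_pos _ _) (gammaCoef_pos _ _))).2 hle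
  unfold Xentry
  rw [min_eq_left (hle.trans hge), h]
  push_cast
  rw [add_sub_cancel_left]

theorem exists_hasDerivAt_Xentry_add {B s : ℝ} (hB : 0 < B) (hs : 0 < s) (m k : ℕ) :
    ∃ d, HasDerivAt (Xentry B m (m + k)) d s ∧
      |d| ≤ 1 / (8 * B * (k : ℝ) ^ 2) * ∑ i ∈ Finset.range k, 1 / ((m : ℝ) + i + 1) := by
  obtain ⟨d, hd, hdle⟩ := exists_hasDerivAt_prod_inv_sqrt hs.le (fun i : ℕ => (m : ℝ) + i + 1)
    (fun i => by positivity) k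
  refine ⟨_, (hd.const_mul (-(1 / (4 * B * (k : ℝ) ^ 2)))).congr_of_eventuallyEq ?_, ?_⟩
  · filter_upwards [lt_mem_nhds hs] with t ht using Xentry_add B m k ht.le
  · rw [abs_mul, abs_neg, abs_of_nonneg (a := 1 / _) (by positivity)]
    refine (mul_le_mul_of_nonneg_left hdle (by positivity)).trans_eq ?_
    simp only [one_div, mul_inv, ← Finset.mul_sum]
    ring

theorem differentiableAt_Xentry {B s : ℝ} (hB : 0 < B) (hs : 0 < s) (m n : ℕ) :
    DifferentiableAt ℝ (Xentry B m n) s := by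
  wlog h : m ≤ n generalizing m n
  · rw [Xentry_comm]
    exact this n m (le_of_not_ge h)
  obtain ⟨k, rfl⟩ := Nat.exists_eq_add_of_le h
  exact (exists_hasDerivAt_Xentry_add hB hs m k).choose_spec.1.differentiableAt

theorem sq_deriv_Xentry_add_le {B s : ℝ} (hB : 0 < B) (hs : 0 < s) (m k : ℕ) :
    |deriv (Xentry B m (m + (k + 1))) s| ^ 2 ≤ 1 / (64 * B ^ 2) * (1 / ((k : ℝ) + 1) ^ 3 *
      ∑ i ∈ Finset.range (k + 1), 1 / ((m + i : ℕ) + 1 : ℝ) ^ 2) := by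
  obtain ⟨d, hd, hdle⟩ := exists_hasDerivAt_Xentry_add hB hs m (k + 1)
  have hcs := sq_sum_le_card_mul_sum_sq (s := Finset.range (k + 1))
    (f := fun i : ℕ => 1 / ((m : ℝ) + i + 1))
  rw [hd.deriv]
  refine (pow_le_pow_left₀ (abs_nonneg _) hdle 2).trans ?_
  rw [mul_pow]
  refine (mul_le_mul_of_nonneg_left hcs (by positivity)).trans_eq ?_
  simp only [Finset.card_range, one_div, inv_pow]
  push_cast
  field_simp
  norm_num

theorem tsum_ofReal_one_div_succ_sq :
    ∑' k : ℕ, ENNReal.ofReal (1 / ((k : ℝ) + 1) ^ 2) = ENNReal.ofReal (Real.pi ^ 2 / 6) := by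
  have h := (hasSum_nat_add_iff' 1).2 hasSum_zeta_two
  simp only [Finset.range_one, Finset.sum_singleton, Nat.cast_zero, Nat.cast_add, Nat.cast_one] at h
  norm_num at h
  simp only [one_div]
  rw [← ENNReal.ofReal_tsum_of_nonneg (fun k => by positivity) h.summable, h.tsum_eq]

theorem tsum_tsum_sq_deriv_Xentry_add_le {B s : ℝ} (hB : 0 < B) (hs : 0 < s) :
    ∑' m : ℕ, ∑' k : ℕ, ENNReal.ofReal (|deriv (Xentry B m (m + (k + 1))) s| ^ 2) ≤
      ENNReal.ofReal (1 / (64 * B ^ 2) * (Real.pi ^ 2 / 6) ^ 2) := by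
  set c := 1 / (64 * B ^ 2)
  set Z := ENNReal.ofReal (Real.pi ^ 2 / 6) with hZ
  have hc : 0 ≤ c := by positivity
  calc _ ≤ ∑' m : ℕ, ∑' k : ℕ, ENNReal.ofReal c * (ENNReal.ofReal (1 / ((k : ℝ) + 1) ^ 3) *
        ∑ i ∈ Finset.range (k + 1), ENNReal.ofReal (1 / ((m + i : ℕ) + 1 : ℝ) ^ 2)) := by
        refine ENNReal.tsum_le_tsum fun m => ENNReal.tsum_le_tsum fun k => ?_
        rw [← ENNReal.ofReal_sum_of_nonneg (fun i _ => by positivity),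
          ← ENNReal.ofReal_mul (by positivity), ← ENNReal.ofReal_mul hc]
        exact ENNReal.ofReal_le_ofReal (sq_deriv_Xentry_add_le hB hs m k)
    _ = ENNReal.ofReal c * ∑' k : ℕ, ENNReal.ofReal (1 / ((k : ℝ) + 1) ^ 3) *
        ∑ i ∈ Finset.range (k + 1), ∑' m : ℕ, ENNReal.ofReal (1 / ((m + i : ℕ) + 1 : ℝ) ^ 2) := by
        rw [ENNReal.tsum_comm, ← ENNReal.tsum_mul_left]
        refine tsum_congr fun k => ?_
        rw [ENNReal.tsum_mul_left, ENNReal.tsum_mul_left,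
          Summable.tsum_finsetSum fun _ _ => ENNReal.summable]
    _ ≤ ENNReal.ofReal c * ∑' k : ℕ, ENNReal.ofReal (1 / ((k : ℝ) + 1) ^ 2) * Z := by
        refine mul_le_mul_right (ENNReal.tsum_le_tsum fun k => ?_) _
        calc _ ≤ ENNReal.ofReal (1 / ((k : ℝ) + 1) ^ 3) * ∑ i ∈ Finset.range (k + 1), Z := by
              gcongr with i
              rw [hZ, ← tsum_ofReal_one_div_succ_sq]
              exact ENNReal.tsum_comp_le_tsum_of_injective (add_left_injective i)
                (fun j : ℕ => ENNReal.ofReal (1 / ((j : ℝ) + 1) ^ 2))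
          _ = _ := by
              rw [Finset.sum_const, Finset.card_range, nsmul_eq_mul, ← mul_assoc,
                ← ENNReal.ofReal_natCast, ← ENNReal.ofReal_mul (by positivity)]
              congr 2
              push_cast
              field_simp
    _ = _ := by
        rw [ENNReal.tsum_mul_right, tsum_ofReal_one_div_succ_sq, ENNReal.ofReal_mul hc,
          ← ENNReal.ofReal_mul (by positivity), sq (Real.pi ^ 2 / 6)]

theorem tsum_ite_lt_eq_tsum_add (g : ℕ → ENNReal) (m : ℕ) :
    ∑' n, (if m < n then g n else 0) = ∑' k, g (m + (k + 1)) := by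
  have hinj : Function.Injective fun k : ℕ => m + (k + 1) := fun a b h => by
    simpa using h
  rw [← hinj.tsum_eq (f := fun n => if m < n then g n else 0)]
  · exact tsum_congr fun k => if_pos (by omega)
  · intro n hn
    have : m < n := by
      by_contra h
      simp [h] at hn
    exact ⟨n - m - 1, by dsimp only; omega⟩

theorem tsum_prod_symm_off_diag_le (g : ℕ → ℕ → ENNReal) (hg : ∀ m n, g m n = g n m) :
    ∑' p : ℕ × ℕ, (if p.1 = p.2 then 0 else g p.1 p.2) ≤
      2 * ∑' m, ∑' k, g m (m + (k + 1)) := by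
  have key : ∀ m n, (if m = n then 0 else g m n) ≤
      (if m < n then g m n else 0) + (if n < m then g n m else 0) := by
    intro m n
    rcases lt_trichotomy m n with h | h | h
    · simp [h, h.ne]
    · simp [h]
    · simp [h, h.ne', hg m n]
  rw [ENNReal.tsum_prod', two_mul]
  refine (ENNReal.tsum_le_tsum fun m => ENNReal.tsum_le_tsum fun n => key m n).trans_eq ?_
  simp only [ENNReal.tsum_add]
  congr 1
  · simp only [tsum_ite_lt_eq_tsum_add]
  · rw [ENNReal.tsum_comm]
    simp only [tsum_ite_lt_eq_tsum_add]

/-- For `B > 0` and `s > 0`, the derivatives `d/ds X(s)_{mn}` exist for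
`m ≠ n` and `(∑_{m≠n} |d/ds X(s)_{mn}|²)^{1/2} ≤ (1+√2)·π²/(48B)`; in particular the
matrix of derivatives is Hilbert–Schmidt with Hilbert–Schmidt norm at most this bound. -/
theorem stmt_16 (B s : ℝ) (hB : 0 < B) (hs : 0 < s) :
    (∀ m n : ℕ, m ≠ n → DifferentiableAt ℝ (Xentry B m n) s) ∧
    Summable (fun p : ℕ × ℕ =>
      if p.1 = p.2 then 0 else |deriv (Xentry B p.1 p.2) s| ^ 2) ∧
    Real.sqrt (∑' p : ℕ × ℕ,
        if p.1 = p.2 then 0 else |deriv (Xentry B p.1 p.2) s| ^ 2) ≤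
      (1 + Real.sqrt 2) * Real.pi ^ 2 / (48 * B) := by
  have hle : ∑' p : ℕ × ℕ, ENNReal.ofReal
      (if p.1 = p.2 then 0 else |deriv (Xentry B p.1 p.2) s| ^ 2) ≤
      ENNReal.ofReal (2 * (1 / (64 * B ^ 2) * (Real.pi ^ 2 / 6) ^ 2)) := by
    rw [ENNReal.ofReal_mul zero_le_two, ENNReal.ofReal_ofNat]
    refine le_trans ?_ (mul_le_mul_right (tsum_tsum_sq_deriv_Xentry_add_le hB hs) 2)
    refine le_trans (le_of_eq ?_) (tsum_prod_symm_off_diag_le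
      (fun m n => ENNReal.ofReal (|deriv (Xentry B m n) s| ^ 2))
      fun m n => by rw [Xentry_comm])
    simp only [apply_ite ENNReal.ofReal, ENNReal.ofReal_zero]
  have hnonneg : ∀ p : ℕ × ℕ,
      0 ≤ if p.1 = p.2 then 0 else |deriv (Xentry B p.1 p.2) s| ^ 2 := fun p => by
    split_ifs <;> positivity
  have hsum : Summable (fun p : ℕ × ℕ =>
      if p.1 = p.2 then 0 else |deriv (Xentry B p.1 p.2) s| ^ 2) := by
    simpa only [ENNReal.toReal_ofReal (hnonneg _)] using
      ENNReal.summable_toReal (ne_top_of_le_ne_top ENNReal.ofReal_ne_top hle)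
  refine ⟨fun m n _ => differentiableAt_Xentry hB hs m n, hsum, ?_⟩
  rw [← ENNReal.ofReal_tsum_of_nonneg hnonneg hsum,
    ENNReal.ofReal_le_ofReal_iff (by positivity)] at hle
  refine Real.sqrt_le_iff.2 ⟨by positivity, hle.trans ?_⟩
  have h2 : (2 : ℝ) ≤ (1 + √2) ^ 2 := by
    nlinarith [Real.sq_sqrt (zero_le_two (α := ℝ)), Real.sqrt_nonneg 2]
  calc 2 * (1 / (64 * B ^ 2) * (Real.pi ^ 2 / 6) ^ 2)
      = 2 * (Real.pi ^ 2 / (48 * B)) ^ 2 := by field_simp; norm_num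
    _ ≤ (1 + √2) ^ 2 * (Real.pi ^ 2 / (48 * B)) ^ 2 := by gcongr
    _ = _ := by ring
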